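/- Let R be a commutative Noetherian ring, let G = Spec O(G) be an affine R-scheme whose coordinate ring O(G) is a flat R-algebra, let X be a separated R-scheme admitting a finite cover by affine open subschemes, and let N be a quasi-coherent O_X-module with Γ(X, N) = 0. Let p : G ×_R X → X denote the projection onto the second factor. Then Γ(G ×_R X, p*N) = 0. -/

import Mathlib

open CategoryTheory AlgebraicGeometry TopologicalSpace

universe u

/-- The morphism of sheaves of rings underlying a morphism of schemes `f : X ⟶ Y`,
from `O_Y` to the pushforward of `O_X`. -/
noncomputable def ringCatSheafHom {X Y : Scheme.{u}} (f : X ⟶ Y) :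
    Y.ringCatSheaf ⟶ ((Opens.map f.base).sheafPushforwardContinuous RingCat.{u}
      (Opens.grothendieckTopology Y) (Opens.grothendieckTopology X)).obj X.ringCatSheaf :=
  ⟨Functor.whiskerRight f.c (forget₂ CommRingCat RingCat)⟩

/-- The pushforward `f_*` of sheaves of modules along a morphism of schemes `f : X ⟶ Y`. -/
noncomputable def Scheme.Modules.pushforward {X Y : Scheme.{u}} (f : X ⟶ Y) :
    X.Modules ⥤ Y.Modules :=
  SheafOfModules.pushforward.{u} (ringCatSheafHom f)

/-- A sheaf of `O_X`-modules `P` *is a pullback* of the sheaf of `O_Y`-modules `N` along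
`f : X ⟶ Y` (i.e. `P ≅ f*N = O_X ⊗_{f⁻¹O_Y} f⁻¹N`) if it satisfies the universal property
of the pullback of `O`-modules: there is a unit morphism `η : N ⟶ f_* P` through which every
morphism `N ⟶ f_* Q` factors uniquely. -/
def IsModulePullback {X Y : Scheme.{u}} (f : X ⟶ Y) (N : Y.Modules) (P : X.Modules) : Prop :=
  ∃ η : N ⟶ (Scheme.Modules.pushforward f).obj P,
    ∀ (Q : X.Modules) (ψ : N ⟶ (Scheme.Modules.pushforward f).obj Q),
      ∃! g : P ⟶ Q, η ≫ (Scheme.Modules.pushforward f).map g = ψ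

namespace TensorProduct

section

variable {R A M P : Type*} [CommRing R] [CommRing A] [Algebra R A] [AddCommGroup M]
    [AddCommGroup P] [Module R M] [Module A P]

/-- The `A`-linear map `A ⊗[R] M → P`, `a ⊗ m ↦ a • ℓ m`, induced by a semilinear map `ℓ`. -/
noncomputable def semilinearLift (ℓ : M →ₛₗ[algebraMap R A] P) : A ⊗[R] M →ₗ[A] P :=
  letI := Module.compHom P (algebraMap R A)
  haveI : IsScalarTower R A P := .of_algebraMap_smul fun _ _ ↦ rfl
  (isBaseChange R M A).lift { toFun := ℓ, map_add' := ℓ.map_add, map_smul' := ℓ.map_smulₛₗ }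

theorem semilinearLift_one_tmul (ℓ : M →ₛₗ[algebraMap R A] P) (m : M) :
    semilinearLift ℓ (1 ⊗ₜ m) = ℓ m :=
  letI := Module.compHom P (algebraMap R A)
  haveI : IsScalarTower R A P := .of_algebraMap_smul fun _ _ ↦ rfl
  (isBaseChange R M A).lift_eq _ _

theorem semilinearLift_tmul (ℓ : M →ₛₗ[algebraMap R A] P) (a : A) (m : M) :
    semilinearLift ℓ (a ⊗ₜ m) = a • ℓ m := by
  rw [← semilinearLift_one_tmul ℓ, ← (semilinearLift ℓ).map_smul, smul_tmul', smul_eq_mul, mul_one]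

theorem semilinearLift_comp {Q : Type*} [AddCommGroup Q] [Module A Q] (f : P →ₗ[A] Q)
    (ℓ : M →ₛₗ[algebraMap R A] P) : ⇑(semilinearLift (f.comp ℓ)) = f ∘ semilinearLift ℓ := by
  ext x
  induction x with
  | zero => simp
  | add x y hx hy => simp_all
  | tmul a m => simp [semilinearLift_tmul]

end

section

variable {R A M P : Type*} [CommRing R] [CommRing A] [Algebra R A] [AddCommGroup M]
    [AddCommGroup P] [Module R M] [Module A P] {B C : Type*} [CommRing B] [CommRing C] [Algebra R B]
    [Algebra R C] [Algebra A C] [Algebra B C] [IsScalarTower R A C] [IsScalarTower R B C]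
    [Algebra.IsPushout R A B C] [Module B M] [IsScalarTower R B M] [Module C P] [IsScalarTower A C P]

theorem bijective_semilinearLift_of_isPushout (ℓ : M →ₛₗ[algebraMap B C] P)
    (ℓ' : M →ₛₗ[algebraMap R A] P) (hℓ : ∀ m, ℓ' m = ℓ m)
    (h : Function.Bijective (semilinearLift ℓ)) :
    Function.Bijective (semilinearLift ℓ') := by
  let e := (Algebra.IsPushout.cancelBaseChange R A B C M).symm
  have : (semilinearLift ℓ' : _ → P) = semilinearLift ℓ ∘ e := by
    ext x
    induction x with
    | zero => simp
    | add x y hx hy => simp_all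
    | tmul a m =>
      simp [semilinearLift_tmul, e, hℓ]
  rw [this]
  exact h.comp e.bijective

end

section

variable {R A : Type*} [CommRing R] [CommRing A] [Algebra R A] [Module.Flat R A]
  {ι κ : Type*} [Finite ι] [Finite κ] {M P : ι → Type*} {M' P' : κ → Type*}
  [∀ i, AddCommGroup (M i)] [∀ i, Module R (M i)] [∀ i, AddCommGroup (P i)] [∀ i, Module A (P i)]
  [∀ i, AddCommGroup (M' i)] [∀ i, Module R (M' i)] [∀ i, AddCommGroup (P' i)] [∀ i, Module A (P' i)]

/-- Vanishing of an equalizer of finite products is preserved by flat base change. -/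
theorem eq_zero_of_flat_of_bijective_semilinearLift {s t : κ → ι}
    (ℓ : ∀ i, M i →ₛₗ[algebraMap R A] P i) (ℓ' : ∀ k, M' k →ₛₗ[algebraMap R A] P' k)
    (hℓ : ∀ i, Function.Bijective (semilinearLift (ℓ i)))
    (hℓ' : ∀ k, Function.Injective (semilinearLift (ℓ' k)))
    (f : ∀ k, M (s k) →ₗ[R] M' k) (g : ∀ k, M (t k) →ₗ[R] M' k)
    (f' : ∀ k, P (s k) →ₗ[A] P' k) (g' : ∀ k, P (t k) →ₗ[A] P' k)
    (hf : ∀ k m, f' k (ℓ _ m) = ℓ' k (f k m)) (hg : ∀ k m, g' k (ℓ _ m) = ℓ' k (g k m))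
    (hM : ∀ m : ∀ i, M i, (∀ k, f k (m _) = g k (m _)) → m = 0)
    (p : ∀ i, P i) (hp : ∀ k, f' k (p _) = g' k (p _)) : p = 0 := by
  classical
  cases nonempty_fintype ι
  cases nonempty_fintype κ
  let F : (∀ i, M i) →ₗ[R] (∀ k, M' k) :=
    .pi fun k ↦ f k ∘ₗ .proj (s k) - g k ∘ₗ .proj (t k)
  have hF : Function.Injective F := by
    rw [← LinearMap.ker_eq_bot, LinearMap.ker_eq_bot']
    exact fun m hm ↦ hM m fun k ↦ sub_eq_zero.1 (congr_fun hm k)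
  have hAF := Module.Flat.lTensor_preserves_injective_linearMap (M := A) F hF
  choose x hx using fun i ↦ (hℓ i).2 (p i)
  let y := (piRight R A A M).symm x
  have key (k) (z) : semilinearLift (ℓ' k) (piRight R A A M' (F.lTensor A z) k) =
      f' k (semilinearLift (ℓ _) (piRight R A A M z _)) -
        g' k (semilinearLift (ℓ _) (piRight R A A M z _)) := by
    induction z with
    | zero => simp
    | add x y hx hy => simp only [map_add, Pi.add_apply, hx, hy]; abel
    | tmul a m => simp [semilinearLift_tmul, hf, hg, F, tmul_sub]
  have hy : F.lTensor A y = 0 := by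
    apply (piRight R A A M').injective
    ext k
    apply hℓ' k
    rw [key]
    simp [y, hx, hp]
  have hy0 : y = 0 := hAF (by rw [hy, map_zero])
  have hx0 : x = 0 := by simpa [y] using hy0
  ext i
  rw [← hx, hx0, Pi.zero_apply, map_zero, Pi.zero_apply]

end

end TensorProduct

namespace AlgebraicGeometry.Scheme.Modules

/-- A morphism `η : N ⟶ f_* P` exhibits `P` as the pullback of `N` along `f` if every morphism
`N ⟶ f_* Q` factors uniquely through `η`. -/
def IsPullbackUnit {X Y : Scheme.{u}} (f : X ⟶ Y) {N : Y.Modules} {P : X.Modules}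
    (η : N ⟶ (AlgebraicGeometry.Scheme.Modules.pushforward f).obj P) : Prop :=
  ∀ (Q : X.Modules) (ψ : N ⟶ (AlgebraicGeometry.Scheme.Modules.pushforward f).obj Q),
    ∃! g : P ⟶ Q, η ≫ (AlgebraicGeometry.Scheme.Modules.pushforward f).map g = ψ

theorem hom_ext_of_isQuasicoherent {R : CommRingCat.{u}} {M M' : (Spec R).Modules}
    [M.IsQuasicoherent] {g g' : M ⟶ M'} (h : ∀ x : Γ(M, ⊤), g.app ⊤ x = g'.app ⊤ x) : g = g' := by
  have key : (moduleSpecΓFunctor (R := R)).map g = (moduleSpecΓFunctor (R := R)).map g' :=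
    ModuleCat.hom_ext (LinearMap.ext h)
  have h1 := (fromTildeΓNatTrans (R := R)).naturality g
  have h2 := (fromTildeΓNatTrans (R := R)).naturality g'
  have h3 : M.fromTildeΓ ≫ g = M.fromTildeΓ ≫ g' :=
    h1.symm.trans (Eq.trans (by exact congr((tilde.functor R).map $key ≫ M'.fromTildeΓ)) h2)
  have : IsIso M.fromTildeΓ := isIso_fromTildeΓ_of_isQuasicoherent M
  exact (cancel_epi M.fromTildeΓ).1 h3

theorem exists_hom_of_isQuasicoherent {R : CommRingCat.{u}} {M M' : (Spec R).Modules}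
    [M.IsQuasicoherent] (f : Γ(M, ⊤) →ₗ[R] Γ(M', ⊤)) :
    ∃ g : M ⟶ M', ∀ x, g.app ⊤ x = f x := by
  let F : (moduleSpecΓFunctor (R := R)).obj M ⟶ (moduleSpecΓFunctor (R := R)).obj M' :=
    (ModuleCat.ofHom f : ModuleCat.of R Γ(M, ⊤) ⟶ ModuleCat.of R Γ(M', ⊤))
  have : IsIso M.fromTildeΓ := isIso_fromTildeΓ_of_isQuasicoherent M
  let G := ((tilde.adjunction (R := R)).homEquiv _ _).symm F
  refine ⟨inv M.fromTildeΓ ≫ G, fun x ↦ ?_⟩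
  have h1 : (tilde.adjunction (R := R)).unit.app _ ≫ (moduleSpecΓFunctor (R := R)).map G = F := by
    exact ((tilde.adjunction (R := R)).homEquiv_unit ..).symm.trans
      (((tilde.adjunction (R := R)).homEquiv _ _).apply_symm_apply F)
  have h2 := (tilde.adjunction (R := R)).right_triangle_components M
  let y := ((tilde.adjunction (R := R)).unit.app ((moduleSpecΓFunctor (R := R)).obj M)).hom x
  have h5 : M.fromTildeΓ.app ⊤ y = x := congr(($h2).hom x)
  have h6 : G.app ⊤ y = f x := congr(($h1).hom x)
  have h7 : M.fromTildeΓ ≫ inv M.fromTildeΓ ≫ G = G := IsIso.hom_inv_id_assoc _ _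
  have h8 : (M.fromTildeΓ ≫ inv M.fromTildeΓ ≫ G).app ⊤ y = G.app ⊤ y := congr(($h7).app ⊤ y)
  refine Eq.trans ?_ (h8.trans h6)
  exact congr((inv M.fromTildeΓ ≫ G).app ⊤ $h5.symm)

theorem hom_app_smul_Spec {R : CommRingCat.{u}} {M M' : (Spec R).Modules} (g : M ⟶ M')
    (r : R) (x : Γ(M, ⊤)) : g.app ⊤ (r • x) = r • g.app ⊤ x :=
  ((moduleSpecΓFunctor (R := R)).map g).hom.map_smul r x

theorem pushforward_smul_Spec {B C : CommRingCat.{u}} (φ : B ⟶ C) (M : (Spec C).Modules)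
    (r : B) (x : Γ(M, ⊤)) :
    (show Γ(M, ⊤) from (r • (show Γ((pushforward (Spec.map φ)).obj M, ⊤) from x))) =
    φ r • x := by
  have : (Spec.map φ).app ⊤ ((Spec B).presheaf.map (⊤ : (Spec B).Opens).leTop.op ((ΓSpecIso B).inv r)) =
    (Spec C).presheaf.map (⊤ : (Spec C).Opens).leTop.op ((ΓSpecIso C).inv (φ r)) := by
    erw [CategoryTheory.Functor.map_id, CategoryTheory.Functor.map_id]
    exact congr($(ΓSpecIso_inv_naturality φ).hom r).symm
  rw [smul_Spec_def (φ r), ← this]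
  rfl

open TensorProduct

theorem bijective_of_isPullbackUnit {B C : CommRingCat.{u}} [Algebra B C] (φ : B ⟶ C)
    (hφ : ∀ b, φ b = algebraMap B C b)
    {M : (Spec B).Modules} [M.IsQuasicoherent] {P : (Spec C).Modules}
    {η : M ⟶ (pushforward (Spec.map φ)).obj P}
    (hη : IsPullbackUnit _ η) (h : C ⊗[B] Γ(M, ⊤) →ₗ[C] Γ(P, ⊤))
    (hh : ∀ m, h (1 ⊗ₜ m) = η.app ⊤ m) : Function.Bijective h := by
  let K := ModuleCat.of C (C ⊗[B] Γ(M, ⊤))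
  let T : (Spec C).Modules := tilde K
  have : T.IsQuasicoherent := inferInstanceAs (tilde K).IsQuasicoherent
  let e : (C ⊗[B] Γ(M, ⊤)) ≃ₗ[C] Γ(T, ⊤) := (tilde.isoTop K).toLinearEquiv
  let α : Γ(M, ⊤) →ₗ[B] Γ((pushforward (Spec.map φ)).obj T, ⊤) :=
    { toFun m := e (1 ⊗ₜ m)
      map_add' x y := by rw [tmul_add, map_add]; rfl
      map_smul' b x := by
        rw [tmul_smul, ← algebraMap_smul C, e.map_smul, ← hφ]
        exact (pushforward_smul_Spec φ T b _).symm }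
  obtain ⟨ψ, hψ⟩ := exists_hom_of_isQuasicoherent α
  obtain ⟨g, hg, -⟩ := hη T ψ
  obtain ⟨k, hk⟩ := exists_hom_of_isQuasicoherent (h ∘ₗ e.symm.toLinearMap)
  have hg' (m) : g.app ⊤ (η.app ⊤ m) = e (1 ⊗ₜ m) := (congr(($hg).app ⊤ m)).trans (hψ m)
  have hk' (x) : k.app ⊤ (e x) = h x := by simp [hk]
  have hgk : g ≫ k = 𝟙 P := by
    refine (hη P η).unique ?_ ?_
    · refine hom_ext_of_isQuasicoherent fun m ↦ ?_
      change k.app ⊤ (g.app ⊤ (η.app ⊤ m)) = _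
      rw [hg', hk', hh]
    · rw [CategoryTheory.Functor.map_id, Category.comp_id]
  have hgh (x) : g.app ⊤ (h x) = e x := by
    induction x with
    | zero => simp
    | add x y hx hy => rw [map_add, map_add, hx, hy, map_add]
    | tmul c m =>
      have : c ⊗ₜ[B] m = c • (1 ⊗ₜ[B] m) := by simp [smul_tmul']
      rw [this, h.map_smul, hom_app_smul_Spec, hh, hg', e.map_smul]
  refine ⟨fun x y hxy ↦ e.injective (by rw [← hgh, ← hgh, hxy]), fun y ↦ ⟨e.symm (g.app ⊤ y), ?_⟩⟩
  rw [← hk', e.apply_symm_apply]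
  exact congr(($hgk).app ⊤ y)

section Restrict

variable {X Y U V : Scheme.{u}} (p : Y ⟶ X) (i : U ⟶ X) (j : V ⟶ Y) (q : V ⟶ U)
  (h : j ≫ p = q ≫ i)

/-- The base change isomorphism `p_* j_* ≅ i_* q_*` for a commutative square. -/
noncomputable def pushforwardSquare :
    pushforward j ⋙ pushforward p ≅ pushforward q ⋙ pushforward i :=
  pushforwardComp j p ≪≫ pushforwardCongr h ≪≫ (pushforwardComp q i).symm

variable [IsOpenImmersion i] [IsOpenImmersion j] {N : X.Modules} {P : Y.Modules}

/-- The restriction of a morphism `N ⟶ p_* P` to open subschemes `U ⊆ X` and `V ⊆ Y`. -/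
noncomputable def restrictUnit (η : N ⟶ (pushforward p).obj P) :
    N.restrict i ⟶ (pushforward q).obj (P.restrict j) :=
  ((restrictAdjunction i).homEquiv _ _).symm
    (η ≫ (pushforward p).map ((restrictAdjunction j).unit.app P) ≫
      (pushforwardSquare p i j q h).hom.app (P.restrict j))

theorem isPullbackUnit_restrictUnit {η : N ⟶ (pushforward p).obj P} (hη : IsPullbackUnit p η) :
    IsPullbackUnit q (restrictUnit p i j q h η) := by
  intro Q ψ
  have key (g : P.restrict j ⟶ Q) : restrictUnit p i j q h η ≫ (pushforward q).map g = ψ ↔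
      η ≫ (pushforward p).map ((restrictAdjunction j).homEquiv _ _ g) =
        (restrictAdjunction i).homEquiv _ _ ψ ≫ (pushforwardSquare p i j q h).inv.app Q := by
    rw [← ((restrictAdjunction i).homEquiv _ _).apply_eq_iff_eq, Adjunction.homEquiv_naturality_right,
      restrictUnit, Equiv.apply_symm_apply, Adjunction.homEquiv_unit (restrictAdjunction j),
      ← cancel_mono ((pushforwardSquare p i j q h).hom.app Q)]
    simp only [Category.assoc, Functor.map_comp, Iso.inv_hom_id_app]
    have := (pushforwardSquare p i j q h).hom.naturality g
    simp only [Functor.comp_map] at this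
    erw [this]
    rfl
  simp only [key]
  exact ((restrictAdjunction j).homEquiv _ _).bijective.existsUnique_iff.1 (hη _ _)

theorem image_preimage_le_preimage_image {X Y U V : Scheme.{u}} (p : Y ⟶ X) (i : U ⟶ X)
    (j : V ⟶ Y) (q : V ⟶ U) (h : j ≫ p = q ≫ i) [IsOpenImmersion i] [IsOpenImmersion j]
    (W : U.Opens) : j ''ᵁ (q ⁻¹ᵁ W) ≤ p ⁻¹ᵁ (i ''ᵁ W) := by
  have : q ⁻¹ᵁ W = j ⁻¹ᵁ (p ⁻¹ᵁ (i ''ᵁ W)) := by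
    rw [← Scheme.Hom.comp_preimage, h, Scheme.Hom.comp_preimage, Scheme.Hom.preimage_image_eq]
  rw [this]
  exact j.image_preimage_le _

theorem restrictUnit_app (η : N ⟶ (pushforward p).obj P) (W : U.Opens) :
    (restrictUnit p i j q h η).app W = η.app (i ''ᵁ W) ≫
      P.presheaf.map (homOfLE (image_preimage_le_preimage_image p i j q h W)).op := by
  rw [restrictUnit, Adjunction.homEquiv_counit]
  let a : j ''ᵁ (j ⁻¹ᵁ (p ⁻¹ᵁ (i ''ᵁ W))) ⟶ p ⁻¹ᵁ (i ''ᵁ W) := homOfLE (j.image_preimage_le _)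
  let b : j ''ᵁ (q ⁻¹ᵁ (i ⁻¹ᵁ (i ''ᵁ W))) ⟶ j ''ᵁ (j ⁻¹ᵁ (p ⁻¹ᵁ (i ''ᵁ W))) := eqToHom (by
    simp only [← Scheme.Hom.comp_preimage, h])
  let c : j ''ᵁ (q ⁻¹ᵁ W) ⟶ j ''ᵁ (q ⁻¹ᵁ (i ⁻¹ᵁ (i ''ᵁ W))) := eqToHom (by
    rw [Scheme.Hom.preimage_image_eq])
  have : P.presheaf.map (homOfLE (image_preimage_le_preimage_image p i j q h W)).op =
      P.presheaf.map a.op ≫ P.presheaf.map b.op ≫ P.presheaf.map c.op := by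
    simp only [← Functor.map_comp]
    rfl
  rw [this]
  rfl

end Restrict

section Sections

variable {R : Type u} [CommRing R] {X : Scheme.{u}} (s : X ⟶ Spec (.of R))

theorem _root_.AlgebraicGeometry.Scheme.Hom.le_preimage_top {X Y : Scheme.{u}} (f : X ⟶ Y)
    (U : X.Opens) : U ≤ f ⁻¹ᵁ ⊤ :=
  fun _ _ ↦ trivial

/-- The ring homomorphism `R ⟶ Γ(X, U)` for an `R`-scheme `X`. -/
noncomputable def scalars (U : X.Opens) : CommRingCat.of R ⟶ Γ(X, U) :=
  (ΓSpecIso (.of R)).inv ≫ s.appLE ⊤ U (s.le_preimage_top U)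

theorem scalars_map {U V : X.Opens} (h : U ≤ V) :
    scalars s V ≫ X.presheaf.map (homOfLE h).op = scalars s U := by
  simp [scalars]

theorem scalars_app {A : Type u} [CommRing A] [Algebra R A] {Y : Scheme.{u}}
    (a : Y ⟶ Spec (.of A)) (p : Y ⟶ X)
    (h : a ≫ Spec.map (CommRingCat.ofHom (algebraMap R A)) = p ≫ s) (U : X.Opens) :
    scalars s U ≫ p.app U = CommRingCat.ofHom (algebraMap R A) ≫ scalars a (p ⁻¹ᵁ U) := by
  rw [scalars, scalars, ΓSpecIso_inv_naturality_assoc, Category.assoc, p.app_eq_appLE,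
    Scheme.Hom.appLE_comp_appLE]
  simp only [← h]
  rw [Scheme.Hom.comp_appLE]
  rfl

theorem scalars_image {B : CommRingCat.{u}} (i : Spec B ⟶ X) [IsOpenImmersion i]
    (φ : CommRingCat.of R ⟶ B) (h : i ≫ s = Spec.map φ) :
    φ ≫ (ΓSpecIso B).inv ≫ (Spec B).presheaf.map (⊤ : (Spec B).Opens).leTop.op ≫
      (i.appIso ⊤).inv = scalars s (i ''ᵁ ⊤) := by
  rw [← Category.assoc, ← Category.assoc, Iso.comp_inv_eq, Scheme.Hom.appIso_hom', scalars]
  simp only [Category.assoc, Scheme.Hom.appLE_comp_appLE, h]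
  rw [ΓSpecIso_inv_naturality_assoc]
  rfl

/-- The sections of an `O_X`-module over `U`, as an `R`-module, where `X` is an `R`-scheme. -/
def Sections (_ : X ⟶ Spec (.of R)) (N : X.Modules) (U : X.Opens) : Type u := Γ(N, U)

noncomputable instance (N : X.Modules) (U : X.Opens) : AddCommGroup (Sections s N U) :=
  inferInstanceAs (AddCommGroup Γ(N, U))

noncomputable instance (N : X.Modules) (U : X.Opens) : Module R (Sections s N U) :=
  Module.compHom Γ(N, U) (scalars s U).hom

variable {s} {N : X.Modules}

/-- Restriction of sections as an `R`-linear map. -/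
noncomputable def Sections.res {U V : X.Opens} (h : U ≤ V) :
    Sections s N V →ₗ[R] Sections s N U where
  toFun := N.presheaf.map (homOfLE h).op
  map_add' := map_add (N.presheaf.map (homOfLE h).op).hom
  map_smul' r x := (N.map_smul (homOfLE h) _ _).trans
    congr($(scalars_map s h) r • N.presheaf.map (homOfLE h).op x)

variable {A : Type u} [CommRing A] [Algebra R A] {Y : Scheme.{u}} {a : Y ⟶ Spec (.of A)}
  {p : Y ⟶ X} (h : a ≫ Spec.map (CommRingCat.ofHom (algebraMap R A)) = p ≫ s)
  {P : Y.Modules} (η : N ⟶ (pushforward p).obj P)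

/-- The semilinear map on sections induced by `N ⟶ p_* P`. -/
noncomputable def Sections.map (U : X.Opens) :
    Sections s N U →ₛₗ[algebraMap R A] Sections a P (p ⁻¹ᵁ U) where
  toFun := η.app U
  map_add' := map_add (η.app U).hom
  map_smul' r x := (Hom.app_smul η _ _).trans
    congr($(scalars_app s a p h U) r • (show Γ(P, p ⁻¹ᵁ U) from η.app U x))

theorem Sections.map_res {U V : X.Opens} (hUV : U ≤ V) (x : Sections s N V) :
    Sections.map h η U (Sections.res hUV x) =
      Sections.res (p.preimage_mono hUV) (Sections.map h η V x) :=
  congr($(η.mapPresheaf.naturality (homOfLE hUV).op) x)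

end Sections

theorem exists_semilinearMap {B C : CommRingCat.{u}} [Algebra B C] (φ : B ⟶ C)
    (hφ : ∀ b, φ b = algebraMap B C b) {M : (Spec B).Modules} {P : (Spec C).Modules}
    (η : M ⟶ (pushforward (Spec.map φ)).obj P) :
    ∃ ℓ : Γ(M, ⊤) →ₛₗ[algebraMap B C] Γ(P, ⊤), ∀ m, ℓ m = η.app ⊤ m :=
  ⟨{ toFun := η.app ⊤
     map_add' := map_add (η.app ⊤).hom
     map_smul' b m := by
        rw [← hφ]
        exact (hom_app_smul_Spec η b m).trans (pushforward_smul_Spec φ P b _) }, fun _ ↦ rfl⟩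

section

variable {R : Type u} [CommRing R] {X : Scheme.{u}} {s : X ⟶ Spec (.of R)} {N : X.Modules}

/-- Sections over an affine open `Spec B` form a `B`-module. -/
noncomputable abbrev Sections.moduleImage {B : CommRingCat.{u}} (i : Spec B ⟶ X)
    [IsOpenImmersion i] : Module B (Sections s N (i ''ᵁ ⊤)) :=
  inferInstanceAs (Module B Γ(N.restrict i, ⊤))

attribute [local instance] Sections.moduleImage

theorem Sections.isScalarTower_image {B : CommRingCat.{u}} [Algebra R B] (i : Spec B ⟶ X)
    [IsOpenImmersion i] (h : i ≫ s = Spec.map (CommRingCat.ofHom (algebraMap R B))) :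
    IsScalarTower R B (Sections s N (i ''ᵁ ⊤)) :=
  .of_algebraMap_smul fun r x ↦
    congr($(scalars_image s i _ h) r • (show Γ(N, i ''ᵁ ⊤) from x))

theorem Sections.bijective_res {U V : X.Opens} (h : U = V) :
    Function.Bijective (Sections.res (s := s) (N := N) h.le) := by
  subst h
  have : ⇑(Sections.res (s := s) (N := N) (le_refl U)) = id :=
    funext fun x ↦ congr($(N.presheaf.map_id (.op U)) x)
  rw [this]
  exact Function.bijective_id

attribute [local instance] Algebra.TensorProduct.rightAlgebra

variable {A : Type u} [CommRing A] [Algebra R A] {Y : Scheme.{u}} {a : Y ⟶ Spec (.of A)}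
  {p : Y ⟶ X} (H : IsPullback a p (Spec.map (CommRingCat.ofHom (algebraMap R A))) s)
  {P : Y.Modules} {η : N ⟶ (pushforward p).obj P}

theorem bijective_semilinearLift_image_of_isPushout [N.IsQuasicoherent]
    (hη : IsPullbackUnit p η) {B C : CommRingCat.{u}} [Algebra R B] [Algebra R C] [Algebra A C]
    [Algebra B C] [IsScalarTower R A C] [IsScalarTower R B C] [Algebra.IsPushout R A B C]
    (i : Spec B ⟶ X) [IsOpenImmersion i]
    (h : i ≫ s = Spec.map (CommRingCat.ofHom (algebraMap R B))) :
    Function.Bijective (semilinearLift (Sections.map H.w η (i ''ᵁ ⊤))) := by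
  let φ : B ⟶ C := CommRingCat.ofHom (algebraMap B C)
  let q := Spec.map φ
  have hC : IsPullback (Spec.map (CommRingCat.ofHom (algebraMap A C))) q
      (Spec.map (CommRingCat.ofHom (algebraMap R A)))
      (Spec.map (CommRingCat.ofHom (algebraMap R B))) :=
    isPullback_SpecMap_of_isPushout _ _ _ _ (CommRingCat.isPushout_of_isPushout R A B C)
  let j : Spec C ⟶ Y := H.lift (Spec.map (CommRingCat.ofHom (algebraMap A C))) (q ≫ i) (by
    rw [Category.assoc, h, hC.w])
  have hja : j ≫ a = Spec.map (CommRingCat.ofHom (algebraMap A C)) := H.lift_fst _ _ _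
  have hjp : j ≫ p = q ≫ i := H.lift_snd _ _ _
  have hj : IsPullback j q p i := by
    refine .of_right ?_ hjp H
    rw [hja, h]
    exact hC
  have : IsOpenImmersion j := MorphismProperty.of_isPullback hj.flip inferInstance
  have hr : j ''ᵁ ⊤ = p ⁻¹ᵁ (i ''ᵁ ⊤) :=
    IsOpenImmersion.image_preimage_eq_preimage_image_of_isPullback hj.flip ⊤
  have hη' := isPullbackUnit_restrictUnit p i j q hjp hη
  obtain ⟨ℓ, hℓ⟩ := exists_semilinearMap (B := B) (C := C) φ (fun _ ↦ rfl)
    (restrictUnit p i j q hjp η)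
  let ℓ' : Sections s N (i ''ᵁ ⊤) →ₛₗ[algebraMap B C] Sections a P (j ''ᵁ ⊤) := ℓ
  have hb : Function.Bijective (semilinearLift ℓ') :=
    bijective_of_isPullbackUnit (B := B) (C := C) φ (fun _ ↦ rfl) hη' (semilinearLift ℓ)
      (fun m ↦ (semilinearLift_one_tmul ℓ m).trans (hℓ m))
  have := Sections.isScalarTower_image (N := N) i h
  have := Sections.isScalarTower_image (N := P) j hja
  have := bijective_semilinearLift_of_isPushout (R := R) (A := A)
    (M := Sections s N (i ''ᵁ ⊤)) (P := Sections a P (j ''ᵁ ⊤)) ℓ'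
    ((Sections.res hr.le).comp (Sections.map H.w η (i ''ᵁ ⊤))) (fun m ↦ ?_) hb
  · rw [semilinearLift_comp] at this
    exact (Function.Bijective.of_comp_iff' (Sections.bijective_res hr) _).1 this
  · refine Eq.trans ?_ (hℓ m).symm
    exact congr($(restrictUnit_app p i j q hjp η ⊤) m).symm

theorem bijective_semilinearLift_image [N.IsQuasicoherent] (hη : IsPullbackUnit p η)
    {B : CommRingCat.{u}} [Algebra R B] (i : Spec B ⟶ X) [IsOpenImmersion i]
    (h : i ≫ s = Spec.map (CommRingCat.ofHom (algebraMap R B))) :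
    Function.Bijective (semilinearLift (Sections.map H.w η (i ''ᵁ ⊤))) :=
  bijective_semilinearLift_image_of_isPushout H hη (C := .of (A ⊗[R] B)) i h

theorem bijective_semilinearLift_of_isAffineOpen [N.IsQuasicoherent] (hη : IsPullbackUnit p η)
    {U : X.Opens} (hU : IsAffineOpen U) :
    Function.Bijective (semilinearLift (Sections.map H.w η U)) := by
  let φ := Spec.preimage (hU.fromSpec ≫ s)
  let : Algebra R Γ(X, U) := φ.hom.toAlgebra
  have := bijective_semilinearLift_image H hη (B := Γ(X, U)) hU.fromSpec
    (Spec.map_preimage (hU.fromSpec ≫ s)).symm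
  rwa [Scheme.Hom.image_top_eq_opensRange, hU.opensRange_fromSpec] at this

end

section

variable {R : Type u} [CommRing R] {X : Scheme.{u}} {s : X ⟶ Spec (.of R)} {N : X.Modules}

theorem Sections.res_res {U V W : X.Opens} (h : U ≤ V) (h' : V ≤ W) (x : Sections s N W) :
    Sections.res h (Sections.res h' x) = Sections.res (h.trans h') x :=
  congr($(N.presheaf.map_comp (homOfLE h').op (homOfLE h).op) x).symm

theorem Sections.eq_of_res_eq {ι : Type*} (U : ι → X.Opens) (hU : ⨆ i, U i = ⊤)
    (x y : Sections s N ⊤) (h : ∀ i, Sections.res le_top x = Sections.res (U := U i) le_top y) :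
    x = y :=
  TopCat.Sheaf.eq_of_locally_eq' ⟨_, N.isSheaf⟩ U ⊤ (fun _ ↦ homOfLE le_top) hU.ge x y h

theorem Sections.exists_res_eq {ι : Type u} (U : ι → X.Opens) (hU : ⨆ i, U i = ⊤)
    (m : ∀ i, Sections s N (U i))
    (h : ∀ k : ι × ι, Sections.res (inf_le_left : U k.1 ⊓ U k.2 ≤ _) (m k.1) =
      Sections.res inf_le_right (m k.2)) :
    ∃ x : Sections s N ⊤, ∀ i, Sections.res le_top x = m i :=
  (TopCat.Sheaf.existsUnique_gluing' ⟨_, N.isSheaf⟩ U ⊤ (fun _ ↦ homOfLE le_top) hU.ge m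
    (fun i j ↦ h (i, j))).exists

variable {A : Type u} [CommRing A] [Algebra R A] {Y : Scheme.{u}} {a : Y ⟶ Spec (.of A)}
  {p : Y ⟶ X}

/-- Flat base change for the vanishing of global sections of a quasi-coherent module. -/
theorem subsingleton_of_isPullbackUnit [Module.Flat R A] [IsSeparated s]
    (H : IsPullback a p (Spec.map (CommRingCat.ofHom (algebraMap R A))) s)
    {P : Y.Modules} {η : N ⟶ (pushforward p).obj P} [N.IsQuasicoherent]
    (hη : IsPullbackUnit p η) {ι : Type u} [Finite ι] (U : ι → X.Opens)
    (hU : ∀ i, IsAffineOpen (U i)) (hU' : ⨆ i, U i = ⊤) (hN : Subsingleton Γ(N, ⊤)) :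
    Subsingleton Γ(P, ⊤) := by
  have hinf (k : ι × ι) : IsAffineOpen (U k.1 ⊓ U k.2) :=
    (isAffineHom_diagonal_iff (f := s)).mp inferInstance ⊤
      (isAffineOpen_top _) _ le_top _ le_top (hU _) (hU _)
  have hM (m : ∀ i, Sections s N (U i))
      (h : ∀ k : ι × ι, Sections.res (inf_le_left : U k.1 ⊓ U k.2 ≤ _) (m k.1) =
        Sections.res inf_le_right (m k.2)) : m = 0 := by
    obtain ⟨x, hx⟩ := Sections.exists_res_eq U hU' m h
    have : x = 0 := hN.elim x 0
    ext i
    rw [← hx, this, map_zero, Pi.zero_apply]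
  have hV : ⨆ i, p ⁻¹ᵁ U i = ⊤ := by
    rw [← Scheme.Hom.preimage_iSup, hU', Scheme.Hom.preimage_top]
  suffices ∀ x : Sections a P ⊤, x = 0 from ⟨fun x y ↦ (this x).trans (this y).symm⟩
  intro x
  refine Sections.eq_of_res_eq (fun i ↦ p ⁻¹ᵁ U i) hV x 0 fun i ↦ ?_
  rw [map_zero]
  exact congrFun (eq_zero_of_flat_of_bijective_semilinearLift
    (ℓ := fun i ↦ Sections.map H.w η (U i))
    (ℓ' := fun k : ι × ι ↦ Sections.map H.w η (U k.1 ⊓ U k.2))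
    (hℓ := fun i ↦ bijective_semilinearLift_of_isAffineOpen H hη (hU i))
    (hℓ' := fun k ↦ (bijective_semilinearLift_of_isAffineOpen H hη (hinf k)).injective)
    (f := fun _ ↦ Sections.res inf_le_left) (g := fun _ ↦ Sections.res inf_le_right)
    (f' := fun _ ↦ Sections.res (p.preimage_mono inf_le_left))
    (g' := fun _ ↦ Sections.res (p.preimage_mono inf_le_right))
    (hf := fun _ _ ↦ (Sections.map_res H.w η _ _).symm)
    (hg := fun _ _ ↦ (Sections.map_res H.w η _ _).symm) hM
    (fun i ↦ Sections.res le_top x)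
    (fun _ ↦ (Sections.res_res _ _ _).trans (Sections.res_res _ _ _).symm)) i

end

end AlgebraicGeometry.Scheme.Modules

/-- **Vanishing of global sections is preserved by pullback along the projection
`G × X → X`.**  Let `R` be a commutative Noetherian ring, `G = Spec O(G)` an affine
`R`-scheme whose coordinate ring `O(G) = A` is a flat `R`-algebra, `X` a separated
`R`-scheme admitting a finite cover by affine open subschemes, and `N` a quasi-coherent
`O_X`-module with `Γ(X, N) = 0`.  Then `Γ(G ×_R X, p*N) = 0`, where `p : G ×_R X → X`
is the projection onto the second factor. -/
theorem global_sections_pullback_projection_eq_zero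
    {R : Type u} [CommRing R] [IsNoetherianRing R]
    (A : Type u) [CommRing A] [Algebra R A] [Module.Flat R A]
    (X : Scheme.{u}) (sX : X ⟶ Spec (CommRingCat.of R)) [IsSeparated sX]
    (hcover : ∃ (n : ℕ) (U : Fin n → X.Opens),
      (∀ i, IsAffineOpen (U i)) ∧ (⨆ i, U i) = ⊤)
    (N : X.Modules) [N.IsQuasicoherent]
    (hN : Subsingleton (N.val.obj (Opposite.op ⊤)))
    (P : (Limits.pullback
      (Spec.map (CommRingCat.ofHom (algebraMap R A))) sX).Modules)
    (hP : IsModulePullback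
      (Limits.pullback.snd (Spec.map (CommRingCat.ofHom (algebraMap R A))) sX) N P) :
    Subsingleton (P.val.obj (Opposite.op ⊤)) := by
  obtain ⟨n, U, hU, hU'⟩ := hcover
  obtain ⟨η, hη⟩ := hP
  exact Scheme.Modules.subsingleton_of_isPullbackUnit (.of_hasPullback _ _) (η := η) hη
    (ι := ULift.{u} (Fin n)) (U ·.down) (fun _ ↦ hU _)
    ((Equiv.ulift.iSup_congr fun _ ↦ rfl).trans hU') hN
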